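/- arXiv:1202.4325 — 2 statements merged into one kernel-verified Lean document; each statement's English description precedes it below -/
import Mathlib

section
/- Fix i ≥ 1 and a_0 ∈ ℚ with a_0 ≠ 0. Then the weighted-homogeneous degree-i part ℚ[a_1, …, a_i]_i equals the ℚ-linear span of the set {A^α_i : α ∈ ℕ_0^i, |α| = i}. -/
/-- The truncated power series `a(k·t) = a₀ + ∑_{j=1}^{i} a_j k^j t^j`, viewed as a
polynomial in `t` with coefficients in `ℚ[a₁, …, a_i]` (the variable `a_{j+1}` is
`MvPolynomial.X j`); only the coefficients `a₀, …, a_i` matter for `A^α_i`. -/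
noncomputable def aPoly (i : ℕ) (a0 : ℚ) (k : ℕ) :
    Polynomial (MvPolynomial (Fin i) ℚ) :=
  Polynomial.C (MvPolynomial.C a0) +
    ∑ j : Fin i, Polynomial.C (MvPolynomial.X j) *
      ((k : Polynomial (MvPolynomial (Fin i) ℚ)) * Polynomial.X) ^ ((j : ℕ) + 1)

/-- `A^α_i`: the coefficient of `t^i` in `A^α(t) = ∏_{j=1}^{i} a(k_j · t)` for the
multi-index `α = (k₁, …, k_i) ∈ ℕ₀^i`. -/
noncomputable def Acoeff (i : ℕ) (a0 : ℚ) (α : Fin i → ℕ) :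
    MvPolynomial (Fin i) ℚ :=
  (∏ j : Fin i, aPoly i a0 (α j)).coeff i

open MvPolynomial Finset in
/-- The form `∏ s, ∏ r < β s, (d • X s - r • ∑ t, X t)`. At the lattice points of the simplex
`∑ t, x t = d` it vanishes unless `β ≤ x`, so when `β` is itself such a point it singles out `β`. -/
noncomputable def simplexLagrange (n d : ℕ) (β : Fin n →₀ ℕ) : MvPolynomial (Fin n) ℚ :=
  ∏ s, ∏ r ∈ range (β s), (C (d : ℚ) * X s - C (r : ℚ) * ∑ t, X t)

theorem simplexLagrange_isHomogeneous (n d : ℕ) (β : Fin n →₀ ℕ) :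
    (simplexLagrange n d β).IsHomogeneous (∑ s, β s) := by
  refine MvPolynomial.IsHomogeneous.prod _ _ _ fun s _ => ?_
  have h := MvPolynomial.IsHomogeneous.prod (Finset.range (β s))
    (fun r : ℕ => (MvPolynomial.C (d : ℚ) * MvPolynomial.X s -
      MvPolynomial.C (r : ℚ) * ∑ t, MvPolynomial.X t : MvPolynomial (Fin n) ℚ))
    (fun _ => 1) fun r _ => ?_
  · simpa using h
  · refine ((MvPolynomial.isHomogeneous_X ℚ s).C_mul _).sub (.C_mul ?_ _)
    exact MvPolynomial.IsHomogeneous.sum _ _ _ fun t _ => MvPolynomial.isHomogeneous_X ℚ t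

theorem eval_simplexLagrange {n d : ℕ} (β : Fin n →₀ ℕ) {α : Fin n →₀ ℕ} (hα : ∑ s, α s = d) :
    MvPolynomial.eval (fun s => (α s : ℚ)) (simplexLagrange n d β) =
      ∏ s, ∏ r ∈ Finset.range (β s), ((d : ℚ) * (α s - r)) := by
  have h : ∑ s, (α s : ℚ) = d := by exact_mod_cast hα
  simp only [simplexLagrange, map_prod, map_sub, map_mul, map_sum, MvPolynomial.eval_C,
    MvPolynomial.eval_X, h]
  exact Finset.prod_congr rfl fun s _ => Finset.prod_congr rfl fun r _ => by ring

theorem eval_simplexLagrange_self_ne_zero {n d : ℕ} (hd : d ≠ 0) {β : Fin n →₀ ℕ}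
    (hβ : ∑ s, β s = d) :
    MvPolynomial.eval (fun s => (β s : ℚ)) (simplexLagrange n d β) ≠ 0 := by
  rw [eval_simplexLagrange β hβ]
  refine Finset.prod_ne_zero_iff.2 fun s _ => Finset.prod_ne_zero_iff.2 fun r hr => ?_
  have hr : (r : ℚ) < β s := by exact_mod_cast Finset.mem_range.1 hr
  exact mul_ne_zero (by exact_mod_cast hd) (sub_ne_zero.2 hr.ne')

theorem eval_simplexLagrange_of_ne {n d : ℕ} {α β : Fin n →₀ ℕ} (hα : ∑ s, α s = d)
    (hβ : ∑ s, β s = d) (h : α ≠ β) :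
    MvPolynomial.eval (fun s => (α s : ℚ)) (simplexLagrange n d β) = 0 := by
  obtain ⟨s, hs⟩ : ∃ s, α s < β s := by
    by_contra! hle
    exact h (Finsupp.ext fun s => ((Finset.sum_eq_sum_iff_of_le fun s _ => hle s).1
      (hβ.trans hα.symm) s (Finset.mem_univ s)).symm)
  rw [eval_simplexLagrange β hα]
  refine Finset.prod_eq_zero (Finset.mem_univ s)
    (Finset.prod_eq_zero (Finset.mem_range.2 hs) ?_)
  simp

theorem MvPolynomial.IsHomogeneous.eval_eq_sum_finsuppAntidiag {n d : ℕ}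
    {p : MvPolynomial (Fin n) ℚ} (hp : p.IsHomogeneous d) (x : Fin n → ℚ) :
    MvPolynomial.eval x p =
      ∑ γ ∈ Finset.univ.finsuppAntidiag d, p.coeff γ * ∏ s, x s ^ γ s := by
  rw [MvPolynomial.eval_eq']
  refine Finset.sum_subset (fun γ hγ => ?_) fun γ _ hγ => ?_
  · have h := hp (MvPolynomial.mem_support_iff.1 hγ)
    rw [Finset.mem_finsuppAntidiag]
    refine ⟨?_, Finset.subset_univ _⟩
    simpa [Finsupp.weight_apply, Finsupp.sum_fintype] using h
  · rw [MvPolynomial.notMem_support_iff.1 hγ, zero_mul]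

/-- The lattice points of the simplex are unisolvent for forms of degree `d`, in dual form: each
coefficient functional is a combination of evaluations at those points. -/
theorem exists_sum_mul_prod_pow_eq_ite (n : ℕ) {d : ℕ} (hd : d ≠ 0) :
    ∃ c : (Fin n →₀ ℕ) → (Fin n →₀ ℕ) → ℚ,
      ∀ β ∈ Finset.univ.finsuppAntidiag d, ∀ γ ∈ Finset.univ.finsuppAntidiag d,
        ∑ α ∈ Finset.univ.finsuppAntidiag d, c β α * ∏ s, (α s : ℚ) ^ γ s =
          if β = γ then 1 else 0 := by
  classical
  have hS : ∀ α ∈ Finset.univ.finsuppAntidiag d, ∑ s : Fin n, α s = d :=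
    fun α hα => (Finset.mem_finsuppAntidiag.1 hα).1
  have hsum {p : MvPolynomial (Fin n) ℚ} (hp : p.IsHomogeneous d) (x : Fin n → ℚ) :=
    hp.eval_eq_sum_finsuppAntidiag x
  generalize (Finset.univ.finsuppAntidiag d : Finset (Fin n →₀ ℕ)) = S at hS hsum ⊢
  let M : Matrix S S ℚ := fun α γ => ∏ s, (α.1 s : ℚ) ^ γ.1 s
  let N : Matrix S S ℚ := fun γ β => (simplexLagrange n d β.1).coeff γ.1 *
    (MvPolynomial.eval (fun s => (β.1 s : ℚ)) (simplexLagrange n d β.1))⁻¹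
  have hMN : M * N = 1 := by
    ext α β
    have hβ := simplexLagrange_isHomogeneous n d β.1
    rw [hS β.1 β.2] at hβ
    have h := hsum hβ (fun s => (α.1 s : ℚ))
    have h1 : (M * N) α β =
        MvPolynomial.eval (fun s => (α.1 s : ℚ)) (simplexLagrange n d β.1) *
        (MvPolynomial.eval (fun s => (β.1 s : ℚ)) (simplexLagrange n d β.1))⁻¹ := by
      rw [h, Finset.sum_mul, Matrix.mul_apply, ← Finset.sum_coe_sort S]
      exact Finset.sum_congr rfl fun γ _ => by simp only [M, N]; ring
    rw [h1, Matrix.one_apply]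
    split_ifs with hαβ
    · rw [hαβ]
      exact mul_inv_cancel₀ (eval_simplexLagrange_self_ne_zero hd (hS _ β.2))
    · rw [eval_simplexLagrange_of_ne (hS _ α.2) (hS _ β.2) fun h => hαβ (Subtype.ext h), zero_mul]
  have hNM : N * M = 1 := mul_eq_one_comm.1 hMN
  refine ⟨fun β α => if h : β ∈ S ∧ α ∈ S then N ⟨β, h.1⟩ ⟨α, h.2⟩ else 0, fun β hβ γ hγ => ?_⟩
  have h := congrFun (congrFun hNM ⟨β, hβ⟩) ⟨γ, hγ⟩
  rw [Matrix.mul_apply, Matrix.one_apply] at h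
  simp only [Subtype.mk.injEq] at h
  rw [← h, ← Finset.sum_coe_sort S]
  exact Finset.sum_congr rfl fun α _ => by simp [M, hβ]

/-- The generic coefficient `a_m`, with `a_0` the constant `a0` and `a_m = 0` for `m > i`. -/
noncomputable def aCoeff (i : ℕ) (a0 : ℚ) : ℕ → MvPolynomial (Fin i) ℚ
  | 0 => MvPolynomial.C a0
  | m + 1 => if h : m < i then MvPolynomial.X ⟨m, h⟩ else 0

theorem aCoeff_isWeightedHomogeneous (i : ℕ) (a0 : ℚ) (m : ℕ) :
    (aCoeff i a0 m).IsWeightedHomogeneous (fun s : Fin i => (s : ℕ) + 1) m := by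
  cases m with
  | zero => exact MvPolynomial.isWeightedHomogeneous_C _ _
  | succ m =>
    rw [aCoeff]
    split_ifs with h
    · exact MvPolynomial.isWeightedHomogeneous_X ℚ (fun s : Fin i => (s : ℕ) + 1) ⟨m, h⟩
    · exact MvPolynomial.isWeightedHomogeneous_zero _ _ _

theorem coeff_aPoly (i : ℕ) (a0 : ℚ) (k m : ℕ) :
    (aPoly i a0 k).coeff m = (k : ℚ) ^ m • aCoeff i a0 m := by
  have hterm (j : Fin i) : (Polynomial.C (MvPolynomial.X j) *
      ((k : Polynomial (MvPolynomial (Fin i) ℚ)) * Polynomial.X) ^ ((j : ℕ) + 1)).coeff m =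
      if m = j + 1 then (k : ℚ) ^ m • MvPolynomial.X j else 0 := by
    have : (Polynomial.C (MvPolynomial.X j) *
      ((k : Polynomial (MvPolynomial (Fin i) ℚ)) * Polynomial.X) ^ ((j : ℕ) + 1)) =
      Polynomial.C ((k : ℚ) ^ ((j : ℕ) + 1) • MvPolynomial.X j) *
        Polynomial.X ^ ((j : ℕ) + 1) := by
      rw [MvPolynomial.smul_eq_C_mul]
      simp only [map_mul, map_pow, map_natCast]
      ring
    rw [this, Polynomial.coeff_C_mul_X_pow]
    split_ifs with h
    · rw [h]
    · rfl
  rw [aPoly, Polynomial.coeff_add, Polynomial.finsetSum_coeff]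
  simp only [hterm]
  cases m with
  | zero => simp [aCoeff]
  | succ m =>
    rw [Polynomial.coeff_C_succ, zero_add, aCoeff]
    split_ifs with h
    · rw [Finset.sum_eq_single ⟨m, h⟩ (fun j _ hj => if_neg fun hm => hj ?_) (by simp)]
      · simp
      · exact Fin.ext (Nat.succ_injective hm).symm
    · rw [smul_zero]
      exact Finset.sum_eq_zero fun j _ => if_neg (by have := j.2; omega)

theorem Acoeff_eq_sum (i : ℕ) (a0 : ℚ) (α : Fin i → ℕ) :
    Acoeff i a0 α = ∑ γ ∈ Finset.univ.finsuppAntidiag i,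
      (∏ s, (α s : ℚ) ^ γ s) • ∏ s, aCoeff i a0 (γ s) := by
  rw [Acoeff, ← Polynomial.coeff_coe, ← Polynomial.coeToPowerSeries.ringHom_apply, map_prod,
    PowerSeries.coeff_prod]
  simp only [Polynomial.coeToPowerSeries.ringHom_apply, Polynomial.coeff_coe, coeff_aPoly,
    Finset.prod_smul]

theorem exists_finsupp_prod_eq_list_prod {R : Type*} [CommMonoid R] {n : ℕ} {l : List ℕ}
    (hl : l.length = n) (a : ℕ → R) :
    ∃ f : Fin n →₀ ℕ, ∑ s, f s = l.sum ∧ ∏ s, a (f s) = (l.map a).prod := by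
  subst hl
  refine ⟨Finsupp.equivFunOnFinite.symm l.get, ?_, ?_⟩
  · simp [← List.sum_ofFn]
  · simp [← List.prod_ofFn, List.ofFn_getElem_eq_map]

theorem exists_prod_aCoeff_eq_monomial (i : ℕ) (a0 : ℚ) {d : Fin i →₀ ℕ}
    (hd : Finsupp.weight (fun s : Fin i => (s : ℕ) + 1) d = i) :
    ∃ β : Fin i →₀ ℕ, β ∈ Finset.univ.finsuppAntidiag i ∧ ∃ m : ℕ,
      ∏ s, aCoeff i a0 (β s) = a0 ^ m • MvPolynomial.monomial d (1 : ℚ) := by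
  have hle : ∑ s, d s ≤ i := by
    conv_rhs => rw [← hd, Finsupp.weight_apply, Finsupp.sum_fintype _ _ (by simp)]
    exact Finset.sum_le_sum fun s _ => Nat.le_mul_of_pos_right _ (Nat.succ_pos _)
  let w : Multiset ℕ := d.toMultiset.map fun s : Fin i => (s : ℕ) + 1
  have hcard : w.card = ∑ s, d s := by
    simp [w, Finsupp.card_toMultiset, Finsupp.sum_fintype]
  have hsum : w.sum = i := by
    classical
    rw [Finset.sum_multiset_map_count, Finsupp.toFinset_toMultiset]
    simp only [Finsupp.count_toMultiset]
    exact hd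
  have hprod : (w.map (aCoeff i a0)).prod = MvPolynomial.monomial d 1 := by
    have : aCoeff i a0 ∘ (fun s : Fin i => (s : ℕ) + 1) = MvPolynomial.X := by
      ext1 s
      simp [aCoeff]
    rw [Multiset.map_map, this, Finsupp.toMultiset_map, Finsupp.prod_toMultiset,
      Finsupp.prod_mapDomain_index (by simp) (by simp [pow_add]), MvPolynomial.monomial_eq]
    simp
  obtain ⟨β, hβ, hβ'⟩ := exists_finsupp_prod_eq_list_prod
    (l := w.toList ++ List.replicate (i - ∑ s, d s) 0) (n := i)
    (by simp [hcard, hle]) (aCoeff i a0)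
  refine ⟨β, Finset.mem_finsuppAntidiag.2 ⟨?_, Finset.subset_univ _⟩, i - ∑ s, d s, ?_⟩
  · simpa [hsum] using hβ
  · rw [hβ', List.map_append, List.prod_append, List.map_replicate, List.prod_replicate,
      ← Multiset.prod_coe, ← Multiset.map_coe, Multiset.coe_toList, hprod,
      MvPolynomial.smul_eq_C_mul, map_pow, mul_comm, aCoeff]

theorem prod_aCoeff_mem_span {i : ℕ} (hi : i ≠ 0) (a0 : ℚ) {β : Fin i →₀ ℕ}
    (hβ : β ∈ Finset.univ.finsuppAntidiag i) :
    ∏ s, aCoeff i a0 (β s) ∈ Submodule.span ℚ {p : MvPolynomial (Fin i) ℚ |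
      ∃ α : Fin i → ℕ, (∑ j, α j) = i ∧ p = Acoeff i a0 α} := by
  obtain ⟨c, hc⟩ := exists_sum_mul_prod_pow_eq_ite i hi
  have h : ∏ s, aCoeff i a0 (β s) =
      ∑ α ∈ Finset.univ.finsuppAntidiag i, c β α • Acoeff i a0 α := by
    simp only [Acoeff_eq_sum, Finset.smul_sum, smul_smul]
    rw [Finset.sum_comm]
    simp only [← Finset.sum_smul]
    rw [Finset.sum_congr rfl fun γ hγ => by rw [hc β hβ γ hγ]]
    simp [hβ]
  rw [h]
  exact Submodule.sum_mem _ fun α hα => Submodule.smul_mem _ _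
    (Submodule.subset_span ⟨α, (Finset.mem_finsuppAntidiag.1 hα).1, rfl⟩)


/-- Fix `i ≥ 1` and `a₀ ∈ ℚ`, `a₀ ≠ 0`.  Then the weighted-homogeneous
degree-`i` part `ℚ[a₁, …, a_i]_i` (with weights `deg a_s = s`) equals the `ℚ`-linear span
of the set `{A^α_i : α ∈ ℕ₀^i, |α| = i}`. -/
theorem stmt1 (i : ℕ) (hi : 1 ≤ i) (a0 : ℚ) (ha0 : a0 ≠ 0) :
    MvPolynomial.weightedHomogeneousSubmodule ℚ (fun s : Fin i => (s : ℕ) + 1) i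
      = Submodule.span ℚ {p : MvPolynomial (Fin i) ℚ |
          ∃ α : Fin i → ℕ, (∑ j, α j) = i ∧ p = Acoeff i a0 α} := by
  apply le_antisymm
  · intro p hp
    rw [MvPolynomial.as_sum p]
    refine Submodule.sum_mem _ fun d hd => ?_
    obtain ⟨β, hβ, m, hm⟩ := exists_prod_aCoeff_eq_monomial i a0
      (hp (MvPolynomial.mem_support_iff.1 hd))
    have hmem := prod_aCoeff_mem_span (Nat.one_le_iff_ne_zero.1 hi) a0 hβ
    rw [hm, Submodule.smul_mem_iff _ (pow_ne_zero m ha0)] at hmem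
    simpa [MvPolynomial.smul_monomial] using Submodule.smul_mem _ (p.coeff d) hmem
  · rw [Submodule.span_le]
    rintro _ ⟨α, -, rfl⟩
    rw [Acoeff_eq_sum]
    refine Submodule.sum_mem _ fun γ hγ => Submodule.smul_mem _ _ ?_
    rw [MvPolynomial.mem_weightedHomogeneousSubmodule]
    have h := MvPolynomial.IsWeightedHomogeneous.prod Finset.univ
      (fun s => aCoeff i a0 (γ s)) (fun s => γ s)
      fun s _ => aCoeff_isWeightedHomogeneous i a0 (γ s)
    rwa [(Finset.mem_finsuppAntidiag.1 hγ).1] at h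
end

section
/- Let V be an n-dimensional real inner product space and ω an alternating bilinear form on V. Define |ω|_1 := inf over orthonormal bases (e_1, …, e_n) of V of Σ_{i<j} |ω(e_i, e_j)|, and let |ω| := (Σ_{i<j} ω(e_i, e_j)²)^{1/2} computed in any orthonormal basis (this is independent of the basis). Then |ω| ≤ |ω|_1 ≤ √⌊n/2⌋ · |ω|. -/
/-- The squares of the values of a linear functional on an orthonormal basis have a sum that does
not depend on the basis. -/
theorem OrthonormalBasis.sum_sq_apply_eq {V ι : Type*} [NormedAddCommGroup V]
    [InnerProductSpace ℝ V] [Fintype ι] (b c : OrthonormalBasis ι ℝ V) (f : V →ₗ[ℝ] ℝ) :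
    ∑ i, f (b i) ^ 2 = ∑ i, f (c i) ^ 2 := by
  have : FiniteDimensional ℝ V := b.toBasis.finiteDimensional_of_finite
  have key (d : OrthonormalBasis ι ℝ V) :
      ∑ i, f (d i) ^ 2 = ‖(InnerProductSpace.toDual ℝ V).symm f.toContinuousLinearMap‖ ^ 2 := by
    rw [← d.sum_sq_norm_inner_left]
    refine Finset.sum_congr rfl fun i _ ↦ ?_
    rw [InnerProductSpace.toDual_symm_apply, Real.norm_eq_abs, sq_abs]
    rfl
  rw [key, key]

/-- A sum of a symmetric function over pairs vanishing on the diagonal is twice the sum over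
increasing pairs. -/
theorem Finset.sum_sum_eq_two_mul_sum_lt {n : ℕ} (g : Fin n → Fin n → ℝ)
    (hdiag : ∀ i, g i i = 0) (hsymm : ∀ i j, g i j = g j i) :
    ∑ i, ∑ j, g i j =
      2 * ∑ p ∈ Finset.univ.filter (fun p : Fin n × Fin n ↦ p.1 < p.2), g p.1 p.2 := by
  have hsplit : ∑ i, ∑ j, g i j = ∑ i, ∑ j, (if i < j then g i j else 0) +
      ∑ i, ∑ j, (if j < i then g i j else 0) := by
    simp_rw [← Finset.sum_add_distrib]
    refine Finset.sum_congr rfl fun i _ ↦ Finset.sum_congr rfl fun j _ ↦ ?_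
    rcases lt_trichotomy i j with h | h | h
    · simp [h, h.not_gt]
    · simp [h, hdiag]
    · simp [h, h.not_gt]
  have hswap : ∑ i, ∑ j, (if j < i then g i j else 0) =
      ∑ i, ∑ j, (if i < j then g i j else 0) := by
    rw [Finset.sum_comm]
    refine Finset.sum_congr rfl fun i _ ↦ Finset.sum_congr rfl fun j _ ↦ ?_
    rw [hsymm]
  rw [hsplit, hswap, Finset.sum_filter, Fintype.sum_prod_type, two_mul]

/-- The Euclidean norm of an alternating form does not depend on the orthonormal basis. -/
theorem OrthonormalBasis.sum_lt_sq_alternating_eq {V : Type*} [NormedAddCommGroup V]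
    [InnerProductSpace ℝ V] {n : ℕ} (ω : V →ₗ[ℝ] V →ₗ[ℝ] ℝ) (halt : ω.IsAlt)
    (b c : OrthonormalBasis (Fin n) ℝ V) :
    ∑ p ∈ Finset.univ.filter (fun p : Fin n × Fin n ↦ p.1 < p.2), ω (b p.1) (b p.2) ^ 2 =
      ∑ p ∈ Finset.univ.filter (fun p : Fin n × Fin n ↦ p.1 < p.2), ω (c p.1) (c p.2) ^ 2 := by
  have half (d : OrthonormalBasis (Fin n) ℝ V) :=
    Finset.sum_sum_eq_two_mul_sum_lt (fun i j ↦ ω (d i) (d j) ^ 2)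
      (fun i ↦ by simp [halt (d i)]) (fun i j ↦ by rw [← halt.neg, neg_sq])
  have full : ∑ i, ∑ j, ω (b i) (b j) ^ 2 = ∑ i, ∑ j, ω (c i) (c j) ^ 2 := by
    calc ∑ i, ∑ j, ω (b i) (b j) ^ 2 = ∑ i, ∑ j, ω (b i) (c j) ^ 2 :=
          Finset.sum_congr rfl fun i _ ↦ b.sum_sq_apply_eq c (ω (b i))
      _ = ∑ j, ∑ i, ω.flip (c j) (b i) ^ 2 := Finset.sum_comm
      _ = ∑ j, ∑ i, ω.flip (c j) (c i) ^ 2 :=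
          Finset.sum_congr rfl fun j _ ↦ b.sum_sq_apply_eq c (ω.flip (c j))
      _ = ∑ i, ∑ j, ω (c i) (c j) ^ 2 := Finset.sum_comm
  have := half b
  have := half c
  linarith

/-- A linear functional attaining its maximum over the unit sphere at `v` vanishes on the
orthogonal complement of `v`. -/
theorem LinearMap.apply_eq_zero_of_forall_le_of_inner_eq_zero {V : Type*} [NormedAddCommGroup V]
    [InnerProductSpace ℝ V] [FiniteDimensional ℝ V] (f : V →ₗ[ℝ] ℝ) {v : V} (hv : ‖v‖ = 1)
    (hmax : ∀ w : V, ‖w‖ = 1 → f w ≤ f v) {w : V} (hw : inner ℝ v w = 0) : f w = 0 := by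
  set a := (InnerProductSpace.toDual ℝ V).symm f.toContinuousLinearMap with ha
  have hf (x : V) : f x = inner ℝ a x := by
    rw [ha, InnerProductSpace.toDual_symm_apply]; rfl
  rcases eq_or_ne a 0 with h0 | h0
  · rw [hf, h0, inner_zero_left]
  have hle : ‖a‖ ≤ f v := by
    have hn : ‖a‖ ≠ 0 := norm_ne_zero_iff.2 h0
    have := hmax (‖a‖⁻¹ • a) (by rw [norm_smul, norm_inv, norm_norm, inv_mul_cancel₀ hn])
    rw [hf (‖a‖⁻¹ • a), inner_smul_right, real_inner_self_eq_norm_sq] at this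
    calc ‖a‖ = ‖a‖⁻¹ * ‖a‖ ^ 2 := by field_simp
      _ ≤ f v := this
  have heq : inner ℝ a v = ‖a‖ * ‖v‖ :=
    le_antisymm (real_inner_le_norm a v) (by rw [← hf, hv, mul_one]; exact hle)
  have hav : a = ‖a‖ • v := by
    have := inner_eq_norm_mul_iff_real.1 heq
    rwa [hv, one_smul] at this
  rw [hf, hav, inner_smul_left, hw, mul_zero]

/-- A nonzero alternating form on a finite-dimensional inner product space admits an orthonormal
pair whose span splits off from the form. -/
theorem LinearMap.IsAlt.exists_orthonormal_pair {V : Type*} [NormedAddCommGroup V]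
    [InnerProductSpace ℝ V] [FiniteDimensional ℝ V] {ω : V →ₗ[ℝ] V →ₗ[ℝ] ℝ} (halt : ω.IsAlt)
    (hω : ω ≠ 0) :
    ∃ u v : V, ‖u‖ = 1 ∧ ‖v‖ = 1 ∧ inner ℝ u v = 0 ∧
      (∀ w, inner ℝ v w = 0 → ω u w = 0) ∧ (∀ w, inner ℝ u w = 0 → ω v w = 0) := by
  have : Nontrivial V := by
    by_contra h
    rw [not_nontrivial_iff_subsingleton] at h
    exact hω (Subsingleton.elim _ _)
  have hcont : Continuous fun p : V × V ↦ ω p.1 p.2 := by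
    have h : Continuous fun p : V × V ↦
        (LinearMap.toContinuousLinearMap.toLinearMap ∘ₗ ω).toContinuousLinearMap p.1 p.2 := by
      fun_prop
    exact h
  obtain ⟨x, hx⟩ := exists_norm_eq V zero_le_one
  obtain ⟨⟨u, v⟩, ⟨hu, hv⟩, hmax⟩ :=
    ((isCompact_sphere (0 : V) 1).prod (isCompact_sphere (0 : V) 1)).exists_isMaxOn
      ⟨(x, x), by simpa using hx⟩ hcont.continuousOn
  simp only [mem_sphere_iff_norm, sub_zero] at hu hv
  have hmax' (y z : V) (hy : ‖y‖ = 1) (hz : ‖z‖ = 1) : ω y z ≤ ω u v :=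
    hmax (show (y, z) ∈ Metric.sphere (0 : V) 1 ×ˢ Metric.sphere (0 : V) 1 by simp [hy, hz])
  have h₁ (w : V) (hw : inner ℝ v w = 0) : ω u w = 0 :=
    (ω u).apply_eq_zero_of_forall_le_of_inner_eq_zero hv (fun z hz ↦ hmax' u z hu hz) hw
  have h₂ (w : V) (hw : inner ℝ u w = 0) : ω v w = 0 := by
    rw [← halt.neg, neg_eq_zero]
    exact (ω.flip v).apply_eq_zero_of_forall_le_of_inner_eq_zero hu
      (fun y hy ↦ hmax' y v hy hv) hw
  refine ⟨u, v, hu, hv, ?_, h₁, h₂⟩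
  have hpos : ω u v ≠ 0 := by
    intro h0
    apply hω
    have hle (y z : V) : ω y z ≤ 0 := by
      rcases eq_or_ne y 0 with rfl | hy
      · simp
      rcases eq_or_ne z 0 with rfl | hz
      · simp
      have hy' := norm_pos_iff.2 hy
      have hz' := norm_pos_iff.2 hz
      have := hmax' (‖y‖⁻¹ • y) (‖z‖⁻¹ • z)
        (by rw [norm_smul, norm_inv, norm_norm, inv_mul_cancel₀ hy'.ne'])
        (by rw [norm_smul, norm_inv, norm_norm, inv_mul_cancel₀ hz'.ne'])
      rw [h0, map_smul, map_smul, LinearMap.smul_apply, smul_eq_mul, smul_eq_mul,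
        ← mul_assoc] at this
      exact nonpos_of_mul_nonpos_right this (by positivity)
    ext y z
    refine le_antisymm (hle y z) ?_
    have := hle z y
    rw [← halt.neg] at this
    simpa using this
  -- `v - ⟪u, v⟫ u` is orthogonal to `u`, hence annihilated by `ω v`
  have h₃ := h₂ (v - (inner ℝ u v : ℝ) • u)
    (by rw [inner_sub_right, inner_smul_right, real_inner_self_eq_norm_sq, hu]; ring)
  rw [map_sub, halt v, map_smul, smul_eq_mul, ← halt.neg] at h₃
  have h₄ : (inner ℝ u v : ℝ) * ω u v = 0 := by linarith
  exact (mul_eq_zero.1 h₄).resolve_right hpos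

/-- Normal form of an alternating form on a Euclidean space: in a suitable orthonormal basis, only
the entries at positions `(2k, 2k + 1)` above the diagonal are nonzero. -/
theorem LinearMap.IsAlt.exists_orthonormalBasis {n : ℕ} {V : Type*} [NormedAddCommGroup V]
    [InnerProductSpace ℝ V] [FiniteDimensional ℝ V] {ω : V →ₗ[ℝ] V →ₗ[ℝ] ℝ} (halt : ω.IsAlt)
    (hn : Module.finrank ℝ V = n) :
    ∃ b : OrthonormalBasis (Fin n) ℝ V, ∀ i j : Fin n, i < j → ω (b i) (b j) ≠ 0 →
      i.val % 2 = 0 ∧ j.val = i.val + 1 := by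
  induction n using Nat.strong_induction_on generalizing V with
  | h n ih =>
  by_cases hω : ω = 0
  · exact ⟨(stdOrthonormalBasis ℝ V).reindex (finCongr hn), fun i j _ h ↦ by simp [hω] at h⟩
  obtain ⟨u, v, hu, hv, huv, h₁, h₂⟩ := halt.exists_orthonormal_pair hω
  have hpair : Orthonormal ℝ ![u, v] := by
    simp [orthonormal_iff_ite, Fin.forall_fin_two, hu, hv, huv, real_inner_comm]
  set W := (Submodule.span ℝ (Set.range ![u, v]))ᗮ with hW
  have hspan : Module.finrank ℝ (Submodule.span ℝ (Set.range ![u, v])) = 2 := by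
    simpa using finrank_span_eq_card hpair.linearIndependent
  have hsum := Submodule.finrank_add_finrank_orthogonal (Submodule.span ℝ (Set.range ![u, v]))
  obtain ⟨m, rfl⟩ : ∃ m, n = m + 2 := ⟨n - 2, by omega⟩
  have hWu (w : W) : inner ℝ u (w : V) = 0 :=
    (Submodule.mem_orthogonal _ _).1 w.2 u (Submodule.subset_span ⟨0, rfl⟩)
  have hWv (w : W) : inner ℝ v (w : V) = 0 :=
    (Submodule.mem_orthogonal _ _).1 w.2 v (Submodule.subset_span ⟨1, rfl⟩)
  obtain ⟨c, hc⟩ := ih m (by omega) (V := W) (ω := ω.domRestrict₁₂ W W)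
    (fun w ↦ halt w) (by rw [hspan, hn, ← hW] at hsum; omega)
  have hortho : Orthonormal ℝ
      (Fin.cons u (Fin.cons v (fun i ↦ (c i : V))) : Fin (m + 2) → V) := by
    have hcc (i j : Fin m) : inner ℝ (c i : V) (c j : V) = if i = j then (1 : ℝ) else 0 :=
      orthonormal_iff_ite.1 c.orthonormal i j
    have hWu' (w : W) : inner ℝ (w : V) u = 0 := by rw [real_inner_comm]; exact hWu w
    have hWv' (w : W) : inner ℝ (w : V) v = 0 := by rw [real_inner_comm]; exact hWv w
    have hvu : inner ℝ v u = 0 := by rw [real_inner_comm]; exact huv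
    rw [orthonormal_iff_ite]
    intro i j
    refine Fin.cases ?_ (fun i ↦ Fin.cases ?_ (fun i ↦ ?_) i) i <;>
    refine Fin.cases ?_ (fun j ↦ Fin.cases ?_ (fun j ↦ ?_) j) j <;>
    simp [hu, hv, huv, hvu, hWu, hWv, hWu', hWv', hcc, Fin.ext_iff]
  obtain ⟨b, hb⟩ := Orthonormal.exists_orthonormalBasis_extension_of_card_eq
    (ι := Fin (m + 2)) (by simp [hn]) (s := Set.univ) (hortho.comp _ Subtype.val_injective)
  have hb' (i : Fin (m + 2)) := hb i (Set.mem_univ i)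
  refine ⟨b, fun i j ↦ ?_⟩
  rw [hb', hb']
  refine Fin.cases ?_ (fun i ↦ Fin.cases ?_ (fun i ↦ ?_) i) i <;>
  refine Fin.cases ?_ (fun j ↦ Fin.cases ?_ (fun j ↦ ?_) j) j
  · simp
  · simp
  · simp [h₁ _ (hWv (c j))]
  · simp
  · simp
  · simp [h₂ _ (hWu (c j))]
  · simp
  · simp [Fin.lt_def]
  · intro hij hne
    have := hc i j (by simpa using hij) hne
    simp only [Fin.val_succ]
    omega


/-- Let `V` be an `n`-dimensional real inner product space and `ω` an
alternating bilinear form on `V`.  Define `|ω|₁` as the infimum over orthonormal bases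
`(e₁, …, e_n)` of `∑_{i<j} |ω(e_i, e_j)|`, and let `|ω| = (∑_{i<j} ω(e_i,e_j)²)^{1/2}`
computed in any orthonormal basis.  Then `|ω| ≤ |ω|₁ ≤ √⌊n/2⌋ · |ω|`. -/
theorem stmt6 {V : Type*} [NormedAddCommGroup V] [InnerProductSpace ℝ V]
    {n : ℕ} (ω : V →ₗ[ℝ] V →ₗ[ℝ] ℝ) (halt : ∀ v : V, ω v v = 0)
    (b₀ : OrthonormalBasis (Fin n) ℝ V) :
    Real.sqrt (∑ p ∈ Finset.univ.filter (fun p : Fin n × Fin n => p.1 < p.2),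
        (ω (b₀ p.1) (b₀ p.2)) ^ 2)
      ≤ (⨅ b : OrthonormalBasis (Fin n) ℝ V,
          ∑ p ∈ Finset.univ.filter (fun p : Fin n × Fin n => p.1 < p.2),
            |ω (b p.1) (b p.2)|) ∧
    (⨅ b : OrthonormalBasis (Fin n) ℝ V,
        ∑ p ∈ Finset.univ.filter (fun p : Fin n × Fin n => p.1 < p.2),
          |ω (b p.1) (b p.2)|)
      ≤ Real.sqrt ((n / 2 : ℕ) : ℝ) *
          Real.sqrt (∑ p ∈ Finset.univ.filter (fun p : Fin n × Fin n => p.1 < p.2),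
            (ω (b₀ p.1) (b₀ p.2)) ^ 2) := by
  have hω : ω.IsAlt := halt
  have hbdd : BddBelow (Set.range fun b : OrthonormalBasis (Fin n) ℝ V ↦
      ∑ p ∈ Finset.univ.filter (fun p : Fin n × Fin n => p.1 < p.2), |ω (b p.1) (b p.2)|) :=
    ⟨0, by rintro _ ⟨b, rfl⟩; positivity⟩
  constructor
  · have : Nonempty (OrthonormalBasis (Fin n) ℝ V) := ⟨b₀⟩
    refine le_ciInf fun b ↦ ?_
    rw [b₀.sum_lt_sq_alternating_eq ω hω b]
    refine Real.sqrt_le_iff.2 ⟨by positivity, ?_⟩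
    simp_rw [← sq_abs (ω _ _)]
    exact Finset.sum_sq_le_sq_sum_of_nonneg fun _ _ ↦ abs_nonneg _
  · have : FiniteDimensional ℝ V := b₀.toBasis.finiteDimensional_of_finite
    obtain ⟨b, hb⟩ := hω.exists_orthonormalBasis
      (by simpa using Module.finrank_eq_card_basis b₀.toBasis)
    refine (ciInf_le hbdd b).trans ?_
    rw [b₀.sum_lt_sq_alternating_eq ω hω b, ← Real.sqrt_mul (Nat.cast_nonneg _)]
    apply Real.le_sqrt_of_sq_le
    set S := (Finset.univ.filter (fun p : Fin n × Fin n => p.1 < p.2)) with hS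
    set T := S.filter (fun p ↦ ω (b p.1) (b p.2) ≠ 0) with hT
    have hTmem (p : Fin n × Fin n) (hp : p ∈ T) :
        p.1.val % 2 = 0 ∧ p.2.val = p.1.val + 1 := by
      simp only [hT, hS, Finset.mem_filter, Finset.mem_univ, true_and] at hp
      exact hb p.1 p.2 hp.1 hp.2
    have hcard : T.card ≤ n / 2 := by
      rw [← Finset.card_range (n / 2)]
      refine Finset.card_le_card_of_injOn (fun p ↦ p.1.val / 2) (fun p hp ↦ ?_)
        fun p hp q hq hpq ↦ ?_
      · have := hTmem p hp
        have := p.2.isLt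
        simp only [Finset.coe_range, Set.mem_Iio]
        omega
      · have := hTmem p hp
        have := hTmem q hq
        have : p.1.val / 2 = q.1.val / 2 := hpq
        ext <;> omega
    have habs : ∑ p ∈ S, |ω (b p.1) (b p.2)| = ∑ p ∈ T, |ω (b p.1) (b p.2)| := by
      exact (Finset.sum_filter_of_ne fun p _ hp ↦ abs_ne_zero.1 hp).symm
    calc (∑ p ∈ S, |ω (b p.1) (b p.2)|) ^ 2
        ≤ T.card * ∑ p ∈ T, |ω (b p.1) (b p.2)| ^ 2 := habs ▸ sq_sum_le_card_mul_sum_sq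
      _ = T.card * ∑ p ∈ T, ω (b p.1) (b p.2) ^ 2 := by simp_rw [sq_abs]
      _ ≤ (n / 2 : ℕ) * ∑ p ∈ S, ω (b p.1) (b p.2) ^ 2 := by
          gcongr
          exact Finset.filter_subset _ _
end
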